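/- arXiv:2502.07916 — 2 statements merged into one kernel-verified Lean document; each statement's English description precedes it below -/
import Mathlib

section
/- Let q be a prime power and G, H ∈ 𝔽_q^{k×n} be matrices with no zero columns. Let m be a positive integer with m > m_G and m > m_H, and let G', H' ∈ 𝔽_q^{(k+1)×n'} be obtained from G and H by the Construction (with this m). Suppose S'·G'·M' = H' for some invertible S' ∈ GL_{k+1}(𝔽_q) and monomial matrix M' ∈ 𝔽_q^{n'×n'}. Then M' is block diagonal with three diagonal blocks: there exist monomial matrices M_1 ∈ 𝔽_q^{n×n}, M_2 ∈ 𝔽_q^{nm×nm}, M_3 ∈ 𝔽_q^{(nm+1)×(nm+1)} such that M'[i, j] = 0 whenever indices i and j lie in different blocks of the partition [1, n] ∪ [n+1, n+nm] ∪ [n+nm+1, n'], and the restriction of M' to each block is M_1, M_2, M_3 respectively. -/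
open scoped Classical

/-- A permutation matrix: exactly one `1` in each row and column, `0` elsewhere. -/
def IsPermMatrix {n : ℕ} {F : Type*} [Field F] (P : Matrix (Fin n) (Fin n) F) : Prop :=
  ∃ σ : Equiv.Perm (Fin n), ∀ i j, P i j = if i = σ j then 1 else 0

/-- A signed permutation matrix: exactly one nonzero entry in each row and column,
each equal to `1` or `-1`. -/
def IsSignedPermMatrix {n : ℕ} {F : Type*} [Field F] (P : Matrix (Fin n) (Fin n) F) : Prop :=
  ∃ (σ : Equiv.Perm (Fin n)) (ε : Fin n → F),
    (∀ j, ε j = 1 ∨ ε j = -1) ∧ ∀ i j, P i j = if i = σ j then ε j else 0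

/-- A monomial matrix: exactly one nonzero entry in each row and column. -/
def IsMonomialMatrix {n : ℕ} {F : Type*} [Field F] (P : Matrix (Fin n) (Fin n) F) : Prop :=
  ∃ (σ : Equiv.Perm (Fin n)) (d : Fin n → F),
    (∀ j, d j ≠ 0) ∧ ∀ i j, P i j = if i = σ j then d j else 0

/-- Permutation Code Equivalence. -/
def PCE {k n : ℕ} {F : Type*} [Field F] (G H : Matrix (Fin k) (Fin n) F) : Prop :=
  ∃ (S : Matrix (Fin k) (Fin k) F) (P : Matrix (Fin n) (Fin n) F),
    IsUnit S ∧ IsPermMatrix P ∧ S * G * P = H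

/-- Signed Permutation Code Equivalence. -/
def SPCE {k n : ℕ} {F : Type*} [Field F] (G H : Matrix (Fin k) (Fin n) F) : Prop :=
  ∃ (S : Matrix (Fin k) (Fin k) F) (P : Matrix (Fin n) (Fin n) F),
    IsUnit S ∧ IsSignedPermMatrix P ∧ S * G * P = H

/-- Linear Code Equivalence. -/
def LCE {k n : ℕ} {F : Type*} [Field F] (G H : Matrix (Fin k) (Fin n) F) : Prop :=
  ∃ (S : Matrix (Fin k) (Fin k) F) (P : Matrix (Fin n) (Fin n) F),
    IsUnit S ∧ IsMonomialMatrix P ∧ S * G * P = H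

/-- The number of column indices `j` such that the `j`-th column of `A` equals `c`. -/
noncomputable def colCount {k n : ℕ} {F : Type*} [Field F]
    (A : Matrix (Fin k) (Fin n) F) (c : Fin k → F) : ℕ :=
  (Finset.univ.filter fun j : Fin n => (fun i => A i j) = c).card

/-- `m_A`: the maximum number of times a single column appears among the columns of `A`. -/
noncomputable def maxColCount {k n : ℕ} {F : Type*} [Field F] [Fintype F]
    (A : Matrix (Fin k) (Fin n) F) : ℕ :=
  Finset.univ.sup fun c : Fin k → F => colCount A c

/-- The Construction: `A' = [A'_1 | A'_2 | A'_3]` of size `(k+1) × (n + 2nm + 1)`, where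
`A'_1` is `A` with a row of ones appended, `A'_2` is `Â` (each column of `A` repeated `m`
consecutive times) with a row of zeros appended, and `A'_3` has last row all ones and zeros
elsewhere. -/
def construct {k n : ℕ} {F : Type*} [Field F] (A : Matrix (Fin k) (Fin n) F) (m : ℕ) :
    Matrix (Fin (k + 1)) (Fin (n + 2 * (n * m) + 1)) F :=
  fun i j =>
    if hj1 : (j : ℕ) < n then
      -- block A'_1
      if hi : (i : ℕ) < k then A ⟨i, hi⟩ ⟨j, hj1⟩ else 1
    else if hj2 : (j : ℕ) < n + n * m then
      -- block A'_2
      if hi : (i : ℕ) < k then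
        A ⟨i, hi⟩ ⟨((j : ℕ) - n) / m, by
          have hm : 0 < m := by
            rcases Nat.eq_zero_or_pos m with h | h
            · subst h; omega
            · exact h
          exact (Nat.div_lt_iff_lt_mul hm).mpr (by omega)⟩
      else 0
    else
      -- block A'_3
      if (i : ℕ) < k then 0 else 1

lemma monomial_restrict {N s : ℕ} {F : Type*} [Field F] (M : Matrix (Fin N) (Fin N) F)
    (σ : Equiv.Perm (Fin N)) (d : Fin N → F) (hd : ∀ j, d j ≠ 0)
    (hM : ∀ i j, M i j = if i = σ j then d j else 0)
    (e : Fin s → Fin N) (he : Function.Injective e) (h : ∀ j, ∃ i, σ (e j) = e i) :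
    IsMonomialMatrix (fun i j : Fin s => M (e i) (e j)) := by
  choose f hf using h
  have hfi : Function.Injective f := by
    intro a b hab
    apply he
    apply σ.injective
    rw [hf, hf, hab]
  refine ⟨Equiv.ofBijective f (Finite.injective_iff_bijective.mp hfi), fun j => d (e j),
    fun j => hd _, ?_⟩
  intro i j
  simp only [hM, hf, Equiv.ofBijective_apply, he.eq_iff]

/-- columns proportional -/
def colRel {k N : ℕ} {F : Type*} [Field F] (A : Matrix (Fin k) (Fin N) F) (a b : Fin N) : Prop :=
  ∃ c : F, c ≠ 0 ∧ ∀ i, A i b = c * A i a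

noncomputable def clSize {k N : ℕ} {F : Type*} [Field F] (A : Matrix (Fin k) (Fin N) F)
    (a : Fin N) : ℕ := (Finset.univ.filter fun b => colRel A a b).card

lemma clSize_eq {k N : ℕ} {F : Type*} [Field F] (A B : Matrix (Fin k) (Fin N) F)
    (S : Matrix (Fin k) (Fin k) F) (hS : IsUnit S) (M : Matrix (Fin N) (Fin N) F)
    (σ : Equiv.Perm (Fin N)) (d : Fin N → F) (hd : ∀ j, d j ≠ 0)
    (hM : ∀ i j, M i j = if i = σ j then d j else 0) (heq : S * A * M = B) (a : Fin N) :
    clSize B a = clSize A (σ a) := by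
  have hB : ∀ i j, B i j = d j * (S * A) i (σ j) := by
    intro i j
    rw [← heq, Matrix.mul_apply]
    simp [hM, mul_comm]
  have hrel : ∀ b, colRel B a b ↔ colRel (S * A) (σ a) (σ b) := by
    intro b
    constructor
    · rintro ⟨c, hc, h⟩
      refine ⟨c * d a / d b, by simp [hc, hd], fun i => ?_⟩
      have := h i
      rw [hB, hB] at this
      have hb := hd b
      field_simp
      linear_combination this
    · rintro ⟨c, hc, h⟩
      refine ⟨c * d b / d a, by simp [hc, hd], fun i => ?_⟩
      have ha := hd a
      rw [hB, hB, h]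
      field_simp
  have key : ∀ (T : Matrix (Fin k) (Fin k) F) (C : Matrix (Fin k) (Fin N) F) (x y),
      colRel C x y → colRel (T * C) x y := by
    rintro T C x y ⟨c, hc, h⟩
    refine ⟨c, hc, fun i => ?_⟩
    simp only [Matrix.mul_apply, h, Finset.mul_sum]
    exact Finset.sum_congr rfl fun _ _ => by ring
  have hrel2 : ∀ x y, colRel (S * A) x y ↔ colRel A x y := by
    intro x y
    refine ⟨fun h => ?_, key S A x y⟩
    have := key S⁻¹ _ x y h
    rwa [← Matrix.mul_assoc, Matrix.nonsing_inv_mul _ ((Matrix.isUnit_iff_isUnit_det _).mp hS),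
      Matrix.one_mul] at this
  unfold clSize
  apply Finset.card_equiv σ
  intro b
  simp [hrel, hrel2]

section
variable {k n m : ℕ} {F : Type*} [Field F] (A : Matrix (Fin k) (Fin n) F)

lemma construct_one (i : Fin k) (j : Fin (n + 2 * (n * m) + 1)) (hj : (j : ℕ) < n) :
    construct A m i.castSucc j = A i ⟨j, hj⟩ := by
  simp [construct, hj]

lemma construct_one_last (j : Fin (n + 2 * (n * m) + 1)) (hj : (j : ℕ) < n) :
    construct A m (Fin.last k) j = 1 := by
  simp [construct, hj]

lemma construct_two_last (j : Fin (n + 2 * (n * m) + 1)) (hj : ¬ (j : ℕ) < n)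
    (hj2 : (j : ℕ) < n + n * m) :
    construct A m (Fin.last k) j = 0 := by
  simp [construct, hj, hj2]

lemma construct_three_last (j : Fin (n + 2 * (n * m) + 1)) (hj2 : ¬ (j : ℕ) < n + n * m) :
    construct A m (Fin.last k) j = 1 := by
  have : ¬ (j : ℕ) < n := by
    intro h; apply hj2; exact Nat.lt_add_right _ h
  simp [construct, this, hj2]

lemma construct_three (i : Fin k) (j : Fin (n + 2 * (n * m) + 1))
    (hj2 : ¬ (j : ℕ) < n + n * m) :
    construct A m i.castSucc j = 0 := by
  have : ¬ (j : ℕ) < n := by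
    intro h; apply hj2; exact Nat.lt_add_right _ h
  simp [construct, this, hj2]

lemma construct_two_congr (i : Fin (k+1)) (j j' : Fin (n + 2 * (n * m) + 1))
    (hj : ¬ (j : ℕ) < n) (hj2 : (j : ℕ) < n + n * m)
    (hj' : ¬ (j' : ℕ) < n) (hj2' : (j' : ℕ) < n + n * m)
    (h : ((j : ℕ) - n) / m = ((j' : ℕ) - n) / m) :
    construct A m i j = construct A m i j' := by
  simp [construct, hj, hj2, hj', hj2', h]

lemma size_one [Fintype F] (hA : ∀ j, (fun i => A i j) ≠ 0) (hmA : maxColCount A < m)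
    (j : Fin (n + 2 * (n * m) + 1)) (hj : (j : ℕ) < n) : clSize (construct A m) j < m := by
  refine lt_of_le_of_lt ?_ hmA
  have h1 : colCount A (fun i => A i ⟨j, hj⟩) ≤ maxColCount A :=
    Finset.le_sup (f := fun c : Fin k → F => colCount A c) (Finset.mem_univ _)
  refine le_trans ?_ h1
  unfold clSize colCount
  have hlt : ∀ b, colRel (construct A m) j b → ∃ hb : (b : ℕ) < n,
      (fun i => A i ⟨b, hb⟩) = fun i => A i ⟨j, hj⟩ := by
    rintro b ⟨c, hc, h⟩
    have hl := h (Fin.last k)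
    rw [construct_one_last A j hj, mul_one] at hl
    by_cases hb : (b : ℕ) < n
    · refine ⟨hb, ?_⟩
      rw [construct_one_last A b hb] at hl
      funext i
      have := h i.castSucc
      rwa [construct_one A i j hj, construct_one A i b hb, ← hl, one_mul] at this
    · exfalso
      by_cases hb2 : (b : ℕ) < n + n * m
      · rw [construct_two_last A b hb hb2] at hl
        exact hc hl.symm
      · apply hA ⟨j, hj⟩
        funext i
        have := h i.castSucc
        rw [construct_one A i j hj, construct_three A i b hb2] at this
        simpa [hc] using this.symm
  refine Finset.card_le_card_of_injOn
    (fun b => if hb : (b : ℕ) < n then ⟨b, hb⟩ else ⟨j, hj⟩) ?_ ?_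
  · intro b hb
    simp only [Finset.coe_filter, Finset.mem_univ, true_and, Set.mem_setOf_eq] at hb ⊢
    obtain ⟨h1, h2⟩ := hlt b hb
    simp only [h1, dif_pos]
    exact h2
  · intro b hb b' hb' hbb
    simp only [Finset.coe_filter, Finset.mem_univ, true_and, Set.mem_setOf_eq] at hb hb'
    obtain ⟨h1, -⟩ := hlt b hb
    obtain ⟨h2, -⟩ := hlt b' hb'
    simp only [h1, h2, dif_pos, Fin.mk.injEq] at hbb
    exact Fin.ext hbb

lemma size_two_le (j : Fin (n + 2 * (n * m) + 1)) (hj : ¬ (j : ℕ) < n)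
    (hj2 : (j : ℕ) < n + n * m) : clSize (construct A m) j ≤ n * m := by
  have : ∀ b, colRel (construct A m) j b → n ≤ (b : ℕ) ∧ (b : ℕ) < n + n * m := by
    rintro b ⟨c, hc, h⟩
    have hl := h (Fin.last k)
    rw [construct_two_last A j hj hj2, mul_zero] at hl
    constructor
    · by_contra hb
      rw [construct_one_last A b (by omega)] at hl
      exact one_ne_zero hl
    · by_contra hb
      rw [construct_three_last A b hb] at hl
      exact one_ne_zero hl
  unfold clSize
  calc _ ≤ (Finset.Ico n (n + n * m)).card := by
        refine Finset.card_le_card_of_injOn (fun b => (b : ℕ)) ?_ (Fin.val_injective.injOn)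
        intro b hb
        simp only [Finset.coe_filter, Finset.mem_univ, true_and, Set.mem_setOf_eq] at hb
        simpa using this b hb
    _ = n * m := by simp

lemma size_two_ge (hm : 0 < m) (j : Fin (n + 2 * (n * m) + 1)) (hj : ¬ (j : ℕ) < n)
    (hj2 : (j : ℕ) < n + n * m) : m ≤ clSize (construct A m) j := by
  unfold clSize
  have hlt : ((j : ℕ) - n) / m < n := (Nat.div_lt_iff_lt_mul hm).mpr (by omega)
  set r := ((j : ℕ) - n) / m with hr
  have hb : ∀ t : Fin m, r * m + t < n * m := by
    intro t
    have : (r + 1) * m ≤ n * m := Nat.mul_le_mul_right m hlt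
    have := t.2
    rw [Nat.add_mul] at *
    omega
  calc m = (Finset.univ : Finset (Fin m)).card := by simp
    _ ≤ _ := by
      refine Finset.card_le_card_of_injOn
        (fun t => ⟨n + (r * m + t), by have := hb t; omega⟩) ?_ ?_
      · intro t _
        simp only [Finset.coe_filter, Finset.mem_univ, true_and, Set.mem_setOf_eq]
        refine ⟨1, one_ne_zero, fun i => ?_⟩
        rw [one_mul]
        apply construct_two_congr A i _ _ _ _ hj hj2
        · simp only [Nat.add_sub_cancel_left, ← hr]
          rw [Nat.mul_comm r m, Nat.mul_add_div hm, Nat.div_eq_of_lt t.2, Nat.add_zero]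
        · simp
        · simpa using hb t
      · intro t _ t' _ h
        simp only [Fin.mk.injEq] at h
        exact Fin.ext (by omega)

lemma size_three (j : Fin (n + 2 * (n * m) + 1)) (hj2 : ¬ (j : ℕ) < n + n * m) :
    n * m < clSize (construct A m) j := by
  unfold clSize
  refine Nat.lt_of_succ_le ?_
  calc n * m + 1 = (Finset.univ : Finset (Fin (n * m + 1))).card := by simp
    _ ≤ _ := by
      refine Finset.card_le_card_of_injOn
        (fun t => ⟨n + n * m + t, by have := t.2; omega⟩) ?_ ?_
      · intro t _
        simp only [Finset.coe_filter, Finset.mem_univ, true_and, Set.mem_setOf_eq]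
        refine ⟨1, one_ne_zero, fun i => ?_⟩
        rw [one_mul]
        refine Fin.lastCases ?_ (fun i => ?_) i
        · rw [construct_three_last A j hj2, construct_three_last]
          simp
        · rw [construct_three A i j hj2, construct_three]
          simp
      · intro t _ t' _ h
        simp only [Fin.mk.injEq] at h
        exact Fin.ext (by omega)

end

/-- if `S' * G' * M' = H'` with `S'` invertible and `M'` monomial, then `M'` is
block diagonal with monomial diagonal blocks `M₁ ∈ F^{n×n}`, `M₂ ∈ F^{nm×nm}`,
`M₃ ∈ F^{(nm+1)×(nm+1)}` corresponding to the three column blocks of the Construction. -/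
theorem stmt7 (q k n m : ℕ) (hq : IsPrimePow q) (hk : 0 < k) (hn : 0 < n) (hm : 0 < m)
    (F : Type*) [Field F] [Fintype F] (hF : Fintype.card F = q)
    (G H : Matrix (Fin k) (Fin n) F)
    (hGnz : ∀ j, (fun i => G i j) ≠ 0)
    (hHnz : ∀ j, (fun i => H i j) ≠ 0)
    (hmG : maxColCount G < m) (hmH : maxColCount H < m)
    (S' : Matrix (Fin (k + 1)) (Fin (k + 1)) F) (hS' : IsUnit S')
    (M' : Matrix (Fin (n + 2 * (n * m) + 1)) (Fin (n + 2 * (n * m) + 1)) F)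
    (hM' : IsMonomialMatrix M')
    (heq : S' * construct G m * M' = construct H m) :
    ∃ (M₁ : Matrix (Fin n) (Fin n) F) (M₂ : Matrix (Fin (n * m)) (Fin (n * m)) F)
      (M₃ : Matrix (Fin (n * m + 1)) (Fin (n * m + 1)) F),
      IsMonomialMatrix M₁ ∧ IsMonomialMatrix M₂ ∧ IsMonomialMatrix M₃ ∧
      (∀ i j : Fin (n + 2 * (n * m) + 1),
        (((i : ℕ) < n ∧ ¬ (j : ℕ) < n) ∨ (¬ (i : ℕ) < n ∧ (j : ℕ) < n) ∨
          ((i : ℕ) < n + n * m ∧ ¬ (j : ℕ) < n + n * m) ∨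
          (¬ (i : ℕ) < n + n * m ∧ (j : ℕ) < n + n * m)) →
        M' i j = 0) ∧
      (∀ (i j : ℕ) (hi : i < n) (hj : j < n),
        M' ⟨i, by omega⟩ ⟨j, by omega⟩ = M₁ ⟨i, hi⟩ ⟨j, hj⟩) ∧
      (∀ (i j : ℕ) (hi : i < n * m) (hj : j < n * m),
        M' ⟨n + i, by omega⟩ ⟨n + j, by omega⟩ = M₂ ⟨i, hi⟩ ⟨j, hj⟩) ∧
      (∀ (i j : ℕ) (hi : i < n * m + 1) (hj : j < n * m + 1),
        M' ⟨n + n * m + i, by omega⟩ ⟨n + n * m + j, by omega⟩ = M₃ ⟨i, hi⟩ ⟨j, hj⟩) := by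
  obtain ⟨σ, d, hd, hM⟩ := hM'
  have hsz := clSize_eq _ _ S' hS' M' σ d hd hM heq
  have hmn : m ≤ n * m := Nat.le_mul_of_pos_left m hn
  have hσ : ∀ j, (((σ j : Fin _) : ℕ) < n ↔ (j : ℕ) < n) ∧
      (((σ j : Fin _) : ℕ) < n + n * m ↔ (j : ℕ) < n + n * m) := by
    intro j
    have h := hsz j
    have a1 := size_one H hHnz hmH j
    have a2 := size_two_le (m := m) H j
    have a3 := size_two_ge H hm j
    have a4 := size_three (m := m) H j
    have b1 := size_one G hGnz hmG (σ j)
    have b2 := size_two_le (m := m) G (σ j)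
    have b3 := size_two_ge G hm (σ j)
    have b4 := size_three (m := m) G (σ j)
    by_cases c1 : (j : ℕ) < n <;> by_cases c2 : (j : ℕ) < n + n * m <;>
    by_cases c3 : ((σ j : Fin _) : ℕ) < n <;> by_cases c4 : ((σ j : Fin _) : ℕ) < n + n * m <;>
    simp only [c1, c2, c3, c4, not_true_eq_false, not_false_eq_true, forall_true_left,
      false_implies] at a1 a2 a3 a4 b1 b2 b3 b4 ⊢ <;> first | omega | simp
  refine ⟨_, _, _,
    monomial_restrict M' σ d hd hM (fun i : Fin n => ⟨i, by omega⟩) ?_ ?_,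
    monomial_restrict M' σ d hd hM (fun i : Fin (n * m) => ⟨n + i, by omega⟩) ?_ ?_,
    monomial_restrict M' σ d hd hM (fun i : Fin (n * m + 1) => ⟨n + n * m + i, by omega⟩) ?_ ?_,
    ?_, fun _ _ _ _ => rfl, fun _ _ _ _ => rfl, fun _ _ _ _ => rfl⟩
  · intro a b h
    simp only [Fin.mk.injEq] at h
    exact Fin.ext (by omega)
  · intro j
    have h := hσ ⟨j, by omega⟩
    exact ⟨⟨_, h.1.mpr j.2⟩, rfl⟩
  · intro a b h
    simp only [Fin.mk.injEq] at h
    exact Fin.ext (by omega)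
  · intro j
    have h := hσ ⟨n + j, by omega⟩
    have h2 := h.2.mpr (by simp)
    have h1 := mt h.1.mp (by simp)
    refine ⟨⟨(σ ⟨n + j, by omega⟩ : Fin _) - n, by omega⟩, Fin.ext ?_⟩
    simp only
    omega
  · intro a b h
    simp only [Fin.mk.injEq] at h
    exact Fin.ext (by omega)
  · intro j
    have h := hσ ⟨n + n * m + j, by omega⟩
    have h2 := mt h.2.mp (by simp)
    refine ⟨⟨(σ ⟨n + n * m + j, by omega⟩ : Fin _) - (n + n * m), by omega⟩, Fin.ext ?_⟩
    simp only
    omega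
  · intro i j h
    rw [hM, if_neg]
    rintro rfl
    have := hσ j
    tauto
end

section
/- Let q be a prime power and G, H ∈ 𝔽_q^{k×n} be matrices with no zero columns such that G has full row rank k. Let m be a positive integer with m > m_G and m > m_H, and let G', H' ∈ 𝔽_q^{(k+1)×n'} be obtained from G and H by the Construction (with this m). Suppose S'·G'·M' = H' for some invertible S' ∈ GL_{k+1}(𝔽_q) and signed permutation matrix M' ∈ 𝔽_q^{n'×n'}, and let M_1 ∈ 𝔽_q^{n×n} denote the top-left n×n block of M'. Then there exist a scalar a ∈ {1, −1} ⊆ 𝔽_q and a permutation matrix P ∈ 𝔽_q^{n×n} such that M_1 = a·P. -/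
open scoped Classical

theorem c1 {k n : ℕ} {F : Type*} [Field F] (A : Matrix (Fin k) (Fin n) F) (m : ℕ)
    (j : Fin (n + 2 * (n * m) + 1)) (hj : (j : ℕ) < n) (i : Fin k) :
    construct A m i.castSucc j = A i ⟨j, hj⟩ := by
  simp [construct, hj]

theorem c1l {k n : ℕ} {F : Type*} [Field F] (A : Matrix (Fin k) (Fin n) F) (m : ℕ)
    (j : Fin (n + 2 * (n * m) + 1)) (hj : (j : ℕ) < n) :
    construct A m (Fin.last k) j = 1 := by
  simp [construct, hj]

theorem c2 {k n : ℕ} {F : Type*} [Field F] (A : Matrix (Fin k) (Fin n) F) (m : ℕ)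
    (j : Fin (n + 2 * (n * m) + 1)) (hj : n ≤ (j : ℕ)) (hj2 : (j : ℕ) < n + n * m)
    (i : Fin k) (a : Fin n) (ha : ((j : ℕ) - n) / m = a) :
    construct A m i.castSucc j = A i a := by
  have : ¬ (j : ℕ) < n := by omega
  simp only [construct, this, hj2, dif_pos, dif_neg, not_false_eq_true, Fin.val_castSucc, i.2]
  congr 1
  exact Fin.ext ha

theorem c2l {k n : ℕ} {F : Type*} [Field F] (A : Matrix (Fin k) (Fin n) F) (m : ℕ)
    (j : Fin (n + 2 * (n * m) + 1)) (hj : n ≤ (j : ℕ)) (hj2 : (j : ℕ) < n + n * m) :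
    construct A m (Fin.last k) j = 0 := by
  have : ¬ (j : ℕ) < n := by omega
  simp [construct, this, hj2]

theorem c3 {k n : ℕ} {F : Type*} [Field F] (A : Matrix (Fin k) (Fin n) F) (m : ℕ)
    (j : Fin (n + 2 * (n * m) + 1)) (hj2 : n + n * m ≤ (j : ℕ)) (i : Fin k) :
    construct A m i.castSucc j = 0 := by
  have : ¬ (j : ℕ) < n := by omega
  have h2 : ¬ (j : ℕ) < n + n * m := by omega
  simp [construct, this, h2]

theorem c3l {k n : ℕ} {F : Type*} [Field F] (A : Matrix (Fin k) (Fin n) F) (m : ℕ)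
    (j : Fin (n + 2 * (n * m) + 1)) (hj2 : n + n * m ≤ (j : ℕ)) :
    construct A m (Fin.last k) j = 1 := by
  have : ¬ (j : ℕ) < n := by omega
  have h2 : ¬ (j : ℕ) < n + n * m := by omega
  simp [construct, this, h2]

/-- indices of columns equal to column `j` up to sign -/
noncomputable def cls {K N : ℕ} {F : Type*} [Field F] (B : Matrix (Fin K) (Fin N) F)
    (j : Fin N) : Finset (Fin N) :=
  Finset.univ.filter fun l => ∃ s : F, (s = 1 ∨ s = -1) ∧ ∀ i, B i l = s * B i j

theorem mem_cls {K N : ℕ} {F : Type*} [Field F] {B : Matrix (Fin K) (Fin N) F}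
    {j l : Fin N} (h : l ∈ cls B j) :
    ∃ s : F, (s = 1 ∨ s = -1) ∧ ∀ i, B i l = s * B i j := by
  simpa [cls] using h

theorem cls1 {k n : ℕ} {F : Type*} [Field F] [Fintype F] (A : Matrix (Fin k) (Fin n) F) (m : ℕ)
    (hA : ∀ j, (fun i => A i j) ≠ 0) (hmA : maxColCount A < m)
    (j : Fin (n + 2 * (n * m) + 1)) (hj : (j : ℕ) < n) :
    (cls (construct A m) j).card < m := by
  refine lt_of_le_of_lt ?_ hmA
  have h1 : colCount A (fun i => A i ⟨j, hj⟩) ≤ maxColCount A :=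
    Finset.le_sup (f := fun c : Fin k → F => colCount A c) (Finset.mem_univ _)
  refine le_trans ?_ h1
  have key : ∀ l ∈ cls (construct A m) j, ∃ h : (l : ℕ) < n, ∀ i, A i ⟨l, h⟩ = A i ⟨j, hj⟩ := by
    intro l hl
    obtain ⟨s, hs, h⟩ := mem_cls hl
    have hs0 : s ≠ 0 := by rcases hs with rfl | rfl <;> simp
    have hlast := h (Fin.last k)
    rw [c1l A m j hj, mul_one] at hlast
    by_cases hl1 : (l : ℕ) < n
    · refine ⟨hl1, fun i => ?_⟩
      have := h i.castSucc
      rw [c1 A m l hl1, c1 A m j hj] at this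
      rw [c1l A m l hl1] at hlast
      rw [this, ← hlast, one_mul]
    · exfalso
      by_cases hl2 : (l : ℕ) < n + n * m
      · rw [c2l A m l (by omega) hl2] at hlast
        exact hs0 hlast.symm
      · apply hA ⟨j, hj⟩
        funext i
        have := h i.castSucc
        rw [c3 A m l (by omega), c1 A m j hj] at this
        simpa [hs0] using this.symm
  unfold colCount
  refine Finset.card_le_card_of_injOn (fun l => if h : (l : ℕ) < n then ⟨l, h⟩ else ⟨j, hj⟩) ?_ ?_
  · intro l hl
    obtain ⟨h, h'⟩ := key l hl
    simp only [h, dif_pos, Finset.coe_filter, Finset.mem_univ, true_and, Set.mem_ofPred_eq]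
    exact funext h'
  · intro l hl l' hl' e
    obtain ⟨h, -⟩ := key l hl
    obtain ⟨h', -⟩ := key l' hl'
    simp only [h, h', dif_pos] at e
    exact Fin.ext (by simpa using e)

theorem cls2 {k n : ℕ} {F : Type*} [Field F] (A : Matrix (Fin k) (Fin n) F) (m : ℕ)
    (hm : 0 < m)
    (j : Fin (n + 2 * (n * m) + 1)) (hj : n ≤ (j : ℕ)) (hj2 : (j : ℕ) < n + n * m) :
    m ≤ (cls (construct A m) j).card ∧ (cls (construct A m) j).card ≤ n * m := by
  constructor
  · have ha : ((j : ℕ) - n) / m < n := (Nat.div_lt_iff_lt_mul hm).mpr (by omega)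
    set a := ((j : ℕ) - n) / m with haa
    have hb : a * m + m ≤ n * m := by
      have := Nat.mul_le_mul_right m (Nat.succ_le_of_lt ha)
      rw [Nat.succ_mul] at this
      exact this
    let f : Fin m → Fin (n + 2 * (n * m) + 1) := fun t => ⟨n + (a * m + t), by have := t.2; omega⟩
    have := Finset.card_le_card_of_injOn (s := (Finset.univ : Finset (Fin m)))
      (t := cls (construct A m) j) f ?_ ?_
    · simpa using this
    · intro t _
      have htt := t.2
      refine Finset.mem_coe.mpr (Finset.mem_filter.mpr ⟨Finset.mem_univ _, 1, Or.inl rfl, fun i => ?_⟩)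
      rw [one_mul]
      refine Fin.lastCases ?_ (fun i => ?_) i
      · rw [c2l A m j hj hj2, c2l A m (f t) (by simp [f]) (by simp only [f]; omega)]
      · rw [c2 A m j hj hj2 i ⟨a, ha⟩ rfl,
          c2 A m (f t) (by simp [f]) (by simp only [f]; omega) i ⟨a, ha⟩ ?_]
        simp only [f, Nat.add_sub_cancel_left]
        rw [mul_comm, Nat.mul_add_div hm, Nat.div_eq_of_lt htt, add_zero]
    · intro t _ t' _ e
      simp only [f, Fin.mk.injEq] at e
      exact Fin.ext (by omega)
  · have := Finset.card_le_card_of_injOn (s := cls (construct A m) j)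
      (t := Finset.Ico n (n + n * m)) (fun l => (l : ℕ)) ?_ ?_
    · simpa using this
    · intro l hl
      obtain ⟨s, hs, h⟩ := mem_cls hl
      have hlast := h (Fin.last k)
      rw [c2l A m j hj hj2, mul_zero] at hlast
      simp only [Finset.coe_Ico, Set.mem_Ico]
      by_cases hl1 : (l : ℕ) < n
      · rw [c1l A m l hl1] at hlast
        exact absurd hlast one_ne_zero
      by_cases hl2 : (l : ℕ) < n + n * m
      · omega
      · rw [c3l A m l (by omega)] at hlast
        exact absurd hlast one_ne_zero
    · intro l _ l' _ e
      exact Fin.ext e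

theorem cls3 {k n : ℕ} {F : Type*} [Field F] (A : Matrix (Fin k) (Fin n) F) (m : ℕ)
    (j : Fin (n + 2 * (n * m) + 1)) (hj : n + n * m ≤ (j : ℕ)) :
    n * m < (cls (construct A m) j).card := by
  let f : Fin (n * m + 1) → Fin (n + 2 * (n * m) + 1) :=
    fun t => ⟨n + n * m + t, by have := t.2; omega⟩
  have := Finset.card_le_card_of_injOn (s := (Finset.univ : Finset (Fin (n * m + 1))))
      (t := cls (construct A m) j) f ?_ ?_
  · simp at this
    omega
  · intro t _
    refine Finset.mem_coe.mpr (Finset.mem_filter.mpr ⟨Finset.mem_univ _, 1, Or.inl rfl, fun i => ?_⟩)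
    rw [one_mul]
    refine Fin.lastCases ?_ (fun i => ?_) i
    · rw [c3l A m j hj, c3l A m (f t) (by simp [f])]
    · rw [c3 A m j hj, c3 A m (f t) (by simp [f])]
  · intro t _ t' _ e
    simp only [f, Fin.mk.injEq] at e
    exact Fin.ext (by omega)

theorem cls_card_eq {K N : ℕ} {F : Type*} [Field F] (A B : Matrix (Fin K) (Fin N) F)
    (S : Matrix (Fin K) (Fin K) F) (hS : IsUnit S) (σ : Equiv.Perm (Fin N)) (ε : Fin N → F)
    (hε : ∀ j, ε j = 1 ∨ ε j = -1)
    (h : ∀ j, S.mulVec (fun i => A i (σ j)) = ε j • (fun i => B i j)) (j : Fin N) :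
    (cls B j).card = (cls A (σ j)).card := by
  have hinj : Function.Injective S.mulVec := Matrix.mulVec_injective_of_isUnit hS
  have hsq : ∀ j, ε j * ε j = 1 := fun j => by rcases hε j with h | h <;> simp [h]
  have hmul : ∀ a b : F, (a = 1 ∨ a = -1) → (b = 1 ∨ b = -1) → (a * b = 1 ∨ a * b = -1) := by
    rintro a b (rfl | rfl) (rfl | rfl) <;> simp
  refine Finset.card_equiv σ fun l => ?_
  simp only [cls, Finset.mem_filter, Finset.mem_univ, true_and]
  constructor
  · rintro ⟨s, hs, hl⟩
    refine ⟨ε l * s * ε j, hmul _ _ (hmul _ _ (hε l) hs) (hε j), ?_⟩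
    have : (fun i => A i (σ l)) = (ε l * s * ε j) • (fun i => A i (σ j)) := by
      apply hinj
      rw [Matrix.mulVec_smul, h, h, smul_smul]
      funext i
      simp only [Pi.smul_apply, smul_eq_mul, hl]
      linear_combination (- ε l * s * B i j) * hsq j
    exact fun i => congrFun this i
  · rintro ⟨s, hs, hl⟩
    refine ⟨ε l * s * ε j, hmul _ _ (hmul _ _ (hε l) hs) (hε j), fun i => ?_⟩
    have e : (fun i => A i (σ l)) = s • (fun i => A i (σ j)) := funext hl
    have e2 := congrArg S.mulVec e
    rw [Matrix.mulVec_smul, h, h] at e2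
    have e3 := congrFun e2 i
    simp only [Pi.smul_apply, smul_eq_mul] at e3
    linear_combination ε l * e3 - B i l * hsq l

theorem vecMul_zero_of_rank {k n : ℕ} {F : Type*} [Field F] (G : Matrix (Fin k) (Fin n) F)
    (h : G.rank = k) (w : Fin k → F) (hw : Matrix.vecMul w G = 0) : w = 0 := by
  have hli : LinearIndependent F G.row := by
    rw [linearIndependent_iff_card_eq_finrank_span, Set.finrank, ← Matrix.rank_eq_finrank_span_row, h,
      Fintype.card_fin]
  have := Matrix.vecMul_injective_iff.mpr hli
  exact this (hw.trans (Matrix.zero_vecMul G).symm)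

/-- if `S' * G' * M' = H'` with `S'` invertible and `M'` a signed permutation
matrix, then the top-left `n × n` block of `M'` equals `a • P` for some `a ∈ {1, -1}` and
permutation matrix `P`. -/
theorem stmt14 (q k n m : ℕ) (hq : IsPrimePow q) (hk : 0 < k) (hn : 0 < n) (hm : 0 < m)
    (F : Type*) [Field F] [Fintype F] (hF : Fintype.card F = q)
    (G H : Matrix (Fin k) (Fin n) F)
    (hGnz : ∀ j, (fun i => G i j) ≠ 0)
    (hHnz : ∀ j, (fun i => H i j) ≠ 0)
    (hGrank : G.rank = k)
    (hmG : maxColCount G < m) (hmH : maxColCount H < m)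
    (S' : Matrix (Fin (k + 1)) (Fin (k + 1)) F) (hS' : IsUnit S')
    (M' : Matrix (Fin (n + 2 * (n * m) + 1)) (Fin (n + 2 * (n * m) + 1)) F)
    (hM' : IsSignedPermMatrix M')
    (heq : S' * construct G m * M' = construct H m) :
    ∃ a : F, (a = 1 ∨ a = -1) ∧ ∃ P : Matrix (Fin n) (Fin n) F, IsPermMatrix P ∧
      M'.submatrix (Fin.castLE (by omega)) (Fin.castLE (by omega)) = a • P := by
  obtain ⟨σ, ε, hε, hM⟩ := hM'
  have hsq : ∀ j, ε j * ε j = 1 := fun j => by rcases hε j with h | h <;> simp [h]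
  have hcol : ∀ j, S'.mulVec (fun i => construct G m i (σ j)) =
      ε j • (fun i => construct H m i j) := by
    intro j
    funext i
    have : construct H m i j = (S' * construct G m) i (σ j) * ε j := by
      rw [← heq, Matrix.mul_apply]
      simp [hM]
    rw [Pi.smul_apply, smul_eq_mul, this]
    change (S' * construct G m) i (σ j) = _
    linear_combination (- (S' * construct G m) i (σ j)) * hsq j
  have hcard := cls_card_eq (construct G m) (construct H m) S' hS' σ ε hε hcol
  have hnm : m ≤ n * m := Nat.le_mul_of_pos_left m hn
  have b1 : ∀ j : Fin (n + 2 * (n * m) + 1), (j : ℕ) < n → (σ j : ℕ) < n := by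
    intro j hj
    have h1 := cls1 H m hHnz hmH j hj
    rw [hcard] at h1
    by_contra hc
    by_cases hc2 : (σ j : ℕ) < n + n * m
    · have := cls2 G m hm (σ j) (by omega) hc2
      omega
    · have := cls3 G m (σ j) (by omega)
      omega
  have b3 : ∀ j : Fin (n + 2 * (n * m) + 1), n + n * m ≤ (j : ℕ) → n + n * m ≤ (σ j : ℕ) := by
    intro j hj
    have h1 := cls3 H m j hj
    rw [hcard] at h1
    by_contra hc
    by_cases hc2 : (σ j : ℕ) < n
    · have := cls1 G m hGnz hmG (σ j) hc2
      omega
    · have := cls2 G m hm (σ j) (by omega) (by omega)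
      omega
  have b2 : ∀ j, n ≤ (σ j : ℕ) → (σ j : ℕ) < n + n * m → n ≤ (j : ℕ) ∧ (j : ℕ) < n + n * m := by
    intro j h1 h2
    constructor
    · by_contra hc
      have := b1 j (by omega)
      omega
    · by_contra hc
      have := b3 j (by omega)
      omega
  have hrow : ∀ j, (∑ i : Fin k, S' (Fin.last k) i.castSucc * construct G m i.castSucc (σ j)) +
      S' (Fin.last k) (Fin.last k) * construct G m (Fin.last k) (σ j) =
      ε j * construct H m (Fin.last k) j := by
    intro j
    have := congrFun (hcol j) (Fin.last k)
    rw [Matrix.mulVec, dotProduct, Fin.sum_univ_castSucc] at this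
    exact this
  have hw : (fun i : Fin k => S' (Fin.last k) i.castSucc) = 0 := by
    apply vecMul_zero_of_rank G hGrank
    funext a
    have ha : (a : ℕ) * m + m ≤ n * m := by
      have := Nat.mul_le_mul_right m (Nat.succ_le_of_lt a.2)
      rw [Nat.succ_mul] at this
      exact this
    obtain ⟨j, hj⟩ := σ.surjective ⟨n + a * m, by omega⟩
    have hj' : (σ j : ℕ) = n + a * m := by rw [hj]
    obtain ⟨g1, g2⟩ := b2 j (by omega) (by omega)
    have hr := hrow j
    rw [c2l H m j g1 g2, c2l G m (σ j) (by omega) (by omega), mul_zero, mul_zero, add_zero] at hr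
    rw [Pi.zero_apply, ← hr, Matrix.vecMul, dotProduct]
    refine Finset.sum_congr rfl fun i _ => ?_
    rw [c2 G m (σ j) (by omega) (by omega) i a]
    rw [hj', Nat.add_sub_cancel_left, Nat.mul_div_cancel _ hm]
  have hw' : ∀ i : Fin k, S' (Fin.last k) i.castSucc = 0 := fun i => congrFun hw i
  simp only [hw', zero_mul, Finset.sum_const_zero, zero_add] at hrow
  have hS : S' (Fin.last k) (Fin.last k) = 1 ∨ S' (Fin.last k) (Fin.last k) = -1 := by
    have hr := hrow (Fin.last _)
    have hl : n + n * m ≤ ((Fin.last (n + 2 * (n * m)) : Fin _) : ℕ) := by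
      simp only [Fin.val_last]; omega
    rw [c3l H m _ hl, c3l G m _ (b3 _ hl), mul_one, mul_one] at hr
    rw [hr]
    exact hε _
  have hεa : ∀ j : Fin (n + 2 * (n * m) + 1), (j : ℕ) < n → ε j = S' (Fin.last k) (Fin.last k) := by
    intro j hj
    have hr := hrow j
    rw [c1l H m _ hj, c1l G m _ (b1 _ hj), mul_one, mul_one] at hr
    exact hr.symm
  have hle : n ≤ n + 2 * (n * m) + 1 := by omega
  let f : Fin n → Fin n := fun j => ⟨σ (Fin.castLE hle j), b1 _ j.2⟩
  have hf : Function.Injective f := by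
    intro j j' e
    simp only [f, Fin.mk.injEq] at e
    exact Fin.castLE_injective hle (σ.injective (Fin.ext e))
  let τ : Equiv.Perm (Fin n) := Equiv.ofBijective f (Finite.injective_iff_bijective.mp hf)
  refine ⟨S' (Fin.last k) (Fin.last k), hS, Matrix.of fun i j => if i = τ j then 1 else 0,
    ⟨τ, fun i j => rfl⟩, ?_⟩
  ext i j
  have hiff : Fin.castLE hle i = σ (Fin.castLE hle j) ↔ i = τ j := by
    simp [τ, f, Fin.ext_iff]
  rw [Matrix.submatrix_apply, hM, hεa _ (by simp)]
  simp only [hiff, Matrix.smul_apply, Matrix.of_apply, smul_eq_mul, mul_ite, mul_one, mul_zero]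
end
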